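/- arXiv:2310.14071 — 3 statements merged into one kernel-verified Lean document; each statement's English description precedes it below -/
import Mathlib

section
/- Let k ≥ 2, 1 ≤ r ≤ k−1, and let μ be a pattern of length k. Let n ≥ 2k−r and let i < j be positions with j = i+k−r and j ≤ n−k+1, so that the length-k windows starting at i and j overlap in exactly r positions. Then the proportion of permutations π of {1,…,n} that consecutively contain μ at position i and also at position j is at most 2^{2k−2r}/(2k−r)!. -/
/-- `π` consecutively contains the pattern `μ` of length `k` at (0-indexed) position `i`. -/
def ContainsAt {n k : ℕ} (π : Equiv.Perm (Fin n)) (μ : Equiv.Perm (Fin k))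
    (i : ℕ) (h : i + k ≤ n) : Prop :=
  ∀ a b : Fin k,
    π ⟨i + a.val, by have := a.isLt; omega⟩ < π ⟨i + b.val, by have := b.isLt; omega⟩
      ↔ μ a < μ b

/-- Two order-equivalent injections into a well-ordered type with the same range are equal. -/
theorem eq_of_lt_iff_of_range_eq {α β : Type*} [Finite α] [LinearOrder β] {u v : α → β}
    (hu : Function.Injective u) (h : ∀ a b, u a < u b ↔ v a < v b)
    (hr : Set.range u = Set.range v) : u = v := by
  let _ : LinearOrder α := LinearOrder.lift' u hu
  have hsu : StrictMono u := fun a b hab => hab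
  have hsv : StrictMono v := fun a b hab => (h a b).1 hab
  exact (StrictMono.range_inj hsu hsv).1 hr

theorem exists_equiv_fin_lt_iff {γ β : Type*} [Fintype γ] [LinearOrder β] (f : γ → β)
    (hf : Function.Injective f) :
    ∃ e : γ ≃ Fin (Fintype.card γ), ∀ x y, e x < e y ↔ f x < f y := by
  let _ : LinearOrder γ := LinearOrder.lift' f hf
  exact ⟨(Fintype.orderIsoFinOfCardEq γ rfl).symm.toEquiv,
    fun x y => (Fintype.orderIsoFinOfCardEq γ rfl).symm.lt_iff_lt⟩

/-- A merging of two finite chains is determined by the set of places taken by the first one. -/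
theorem equiv_eq_of_range_inl_eq {α β γ : Type*} [Finite α] [Finite β] [LinearOrder γ]
    {e e' : α ⊕ β ≃ γ}
    (hl : ∀ a b, e (.inl a) < e (.inl b) ↔ e' (.inl a) < e' (.inl b))
    (hr : ∀ a b, e (.inr a) < e (.inr b) ↔ e' (.inr a) < e' (.inr b))
    (hS : Set.range (e ∘ Sum.inl) = Set.range (e' ∘ Sum.inl)) : e = e' := by
  have compl_eq (e : α ⊕ β ≃ γ) : Set.range (e ∘ Sum.inr) = (Set.range (e ∘ Sum.inl))ᶜ := by
    rw [Set.range_comp, Set.range_comp, ← Set.image_compl_eq e.bijective, Set.compl_range_inl]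
  have h1 := eq_of_lt_iff_of_range_eq (e.injective.comp Sum.inl_injective) hl hS
  have h2 := eq_of_lt_iff_of_range_eq (e.injective.comp Sum.inr_injective) hr
    ((compl_eq e).trans ((congrArg _ hS).trans (compl_eq e').symm))
  ext (a | b)
  · exact congrFun h1 a
  · exact congrFun h2 b

/-- If the relative order of `π ∈ P` on the range of `w` is determined by a code `c π`, then
the density of `P` is at most the number of codes divided by the number of orders. -/
theorem card_mul_factorial_le {α β C : Type*} [Fintype α] [Fintype β] [LinearOrder β] [Fintype C]
    (w : α ↪ β) (P : Equiv.Perm β → Prop) (c : {π // P π} → C)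
    (hc : ∀ π ρ, c π = c ρ → ∀ x y, π.1 (w x) < π.1 (w y) ↔ ρ.1 (w x) < ρ.1 (w y)) :
    Nat.card {π // P π} * (Fintype.card α).factorial
      ≤ (Fintype.card β).factorial * Fintype.card C := by
  classical
  have key : Function.Injective (fun q : {π // P π} × Equiv.Perm α =>
      (q.1.1 * q.2.viaEmbedding w, c q.1)) := by
    rintro ⟨π, σ⟩ ⟨ρ, τ⟩ h
    obtain ⟨h1, h2⟩ := Prod.mk.inj h
    have hin (x : α) : π.1 (w (σ x)) = ρ.1 (w (τ x)) := by
      simpa [Equiv.Perm.viaEmbedding_apply] using congrArg (fun f => f (w x)) h1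
    have hrange : Set.range (fun x => π.1 (w x)) = Set.range (fun x => ρ.1 (w x)) := by
      rw [← σ.surjective.range_comp (fun x => π.1 (w x)),
        ← τ.surjective.range_comp (fun x => ρ.1 (w x))]
      exact congrArg Set.range (funext hin)
    have heq := eq_of_lt_iff_of_range_eq (π.1.injective.comp w.injective) (hc π ρ h2) hrange
    have hστ : σ = τ := by
      ext x
      apply (ρ.1.injective.comp w.injective)
      rw [Function.comp_apply, Function.comp_apply, ← hin x]
      exact (congrFun heq (σ x)).symm
    subst hστ
    exact Prod.ext (Subtype.ext (mul_right_cancel h1)) rfl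
  have := Nat.card_le_card_of_injective _ key
  simpa [Nat.card_prod, Fintype.card_perm] using this

theorem ContainsAt.lt_iff_lt {n k i : ℕ} {π ρ : Equiv.Perm (Fin n)} {μ : Equiv.Perm (Fin k)}
    {h : i + k ≤ n} (hπ : ContainsAt π μ i h) (hρ : ContainsAt ρ μ i h) {x y : Fin n}
    (hx : i ≤ x.val) (hx' : x.val < i + k) (hy : i ≤ y.val) (hy' : y.val < i + k) :
    π x < π y ↔ ρ x < ρ y := by
  have h1 := (hπ ⟨x - i, by omega⟩ ⟨y - i, by omega⟩).trans
    (hρ ⟨x - i, by omega⟩ ⟨y - i, by omega⟩).symm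
  simpa [Nat.add_sub_cancel' hx, Nat.add_sub_cancel' hy] using h1

theorem overlap_proportion_bound (k r n i j : ℕ) (hk : 2 ≤ k) (hr1 : 1 ≤ r)
    (hrk : r ≤ k - 1) (hn : 2 * k - r ≤ n) (hij : j = i + (k - r)) (hjn : j + k ≤ n)
    (μ : Equiv.Perm (Fin k)) :
    (Nat.card {π : Equiv.Perm (Fin n) // ∃ (hi : i + k ≤ n) (hj : j + k ≤ n),
        ContainsAt π μ i hi ∧ ContainsAt π μ j hj} : ℝ) / n.factorial ≤
      2 ^ (2 * k - 2 * r) / (2 * k - r).factorial := by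
  obtain ⟨m, rfl⟩ : ∃ m, k = r + m := ⟨k - r, by omega⟩
  obtain rfl : j = i + m := by omega
  let w : Fin (r + m + m) ↪ Fin n :=
    ⟨fun x => ⟨i + x, by omega⟩, fun x y h => by simpa [Fin.ext_iff] using h⟩
  have hw (x) : (w x).val = i + x := rfl
  let d : Fin m ⊕ Fin m → Fin n :=
    Sum.elim (fun a => ⟨i + a, by omega⟩) (fun b => ⟨i + (r + m) + b, by omega⟩)
  have hd : Function.Injective d := by
    rintro (a | a) (b | b) h <;> simp [d, Fin.ext_iff] at h ⊢ <;> omega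
  choose e he using fun π : Equiv.Perm (Fin n) =>
    exists_equiv_fin_lt_iff (π ∘ d) (π.injective.comp hd)
  have key := card_mul_factorial_le w
    (fun π => ∃ (hi : i + (r + m) ≤ n) (hj : i + m + (r + m) ≤ n),
      ContainsAt π μ i hi ∧ ContainsAt π μ (i + m) hj)
    (fun π => Set.range (e π.1 ∘ Sum.inl)) (by
      rintro ⟨π, hi, hj, hπi, hπj⟩ ⟨ρ, _, _, hρi, hρj⟩ hS x y
      have heq : e π = e ρ := by
        refine equiv_eq_of_range_inl_eq (fun a b => ?_) (fun a b => ?_) hS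
        · rw [he, he]
          refine hπi.lt_iff_lt hρi ?_ ?_ ?_ ?_ <;> simp [d] <;> omega
        · rw [he, he]
          refine hπj.lt_iff_lt hρj ?_ ?_ ?_ ?_ <;> simp [d] <;> omega
      have hD (s t) : π (d s) < π (d t) ↔ ρ (d s) < ρ (d t) := by
        have h1 := he π s t
        rw [heq] at h1
        exact h1.symm.trans (he ρ s t)
      have hl (z : Fin (r + m + m)) (hz : z.val < m) : w z = d (.inl ⟨z, hz⟩) := rfl
      have hr (z : Fin (r + m + m)) (hz : r + m ≤ z.val) :
          w z = d (.inr ⟨z - (r + m), by omega⟩) := by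
        apply Fin.ext
        simp only [hw, d, Sum.elim_inr]
        omega
      by_cases hA : x.val < r + m ∧ y.val < r + m
      · refine hπi.lt_iff_lt hρi ?_ ?_ ?_ ?_ <;> rw [hw] <;> omega
      by_cases hB : m ≤ x.val ∧ m ≤ y.val
      · refine hπj.lt_iff_lt hρj ?_ ?_ ?_ ?_ <;> rw [hw] <;> omega
      by_cases hx : x.val < m
      · rw [hl x hx, hr y (by omega)]
        exact hD _ _
      · rw [hr x (by omega), hl y (by omega)]
        exact hD _ _)
  rw [Fintype.card_fin, Fintype.card_fin, Fintype.card_set, Fintype.card_fin, Fintype.card_sum,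
    Fintype.card_fin] at key
  rw [show 2 * (r + m) - 2 * r = m + m by omega, show 2 * (r + m) - r = r + m + m by omega,
    div_le_div_iff₀ (by positivity) (by positivity), mul_comm (2 ^ (m + m) : ℝ)]
  exact_mod_cast key
end

section
/- Let 1 ≤ k, let μ and ν be patterns of length k, and let i, j be positions with j ≥ i+k and j ≤ n−k+1 (so the two length-k windows are disjoint). Then the number of permutations π of {1,…,n} that consecutively contain μ at position i and consecutively contain ν at position j equals n!/(k!)²; in particular, the corresponding indicator events for a uniformly random permutation are independent. -/
/-- `π`, restricted along the embedding `w`, is order-isomorphic to the pattern `μ`. -/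
def HasPatternAlong {n k : ℕ} (w : Fin k ↪ Fin n) (π : Equiv.Perm (Fin n))
    (μ : Equiv.Perm (Fin k)) : Prop :=
  ∀ a b : Fin k, π (w a) < π (w b) ↔ μ a < μ b

/-- The embedding of `Fin k` into `Fin n` as the window starting at `i`. -/
def windowEmbedding {n k : ℕ} (i : ℕ) (h : i + k ≤ n) : Fin k ↪ Fin n where
  toFun a := ⟨i + a.val, by have := a.isLt; omega⟩
  inj' a b hab := by
    have := congrArg Fin.val hab
    exact Fin.ext (Nat.add_left_cancel this)

theorem hasPatternAlong_mul_viaEmbedding {n k : ℕ} (w : Fin k ↪ Fin n)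
    (π : Equiv.Perm (Fin n)) (μ σ : Equiv.Perm (Fin k)) :
    HasPatternAlong w (π * σ.viaEmbedding w) (μ * σ) ↔ HasPatternAlong w π μ := by
  simp only [HasPatternAlong, Equiv.Perm.mul_apply, Equiv.Perm.viaEmbedding_apply]
  refine ⟨fun h a b => ?_, fun h a b => h _ _⟩
  simpa using h (σ⁻¹ a) (σ⁻¹ b)

theorem HasPatternAlong.unique {n k : ℕ} {w : Fin k ↪ Fin n} {π : Equiv.Perm (Fin n)}
    {μ ν : Equiv.Perm (Fin k)} (hμ : HasPatternAlong w π μ) (hν : HasPatternAlong w π ν) :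
    μ = ν := by
  have hmono : StrictMono (ν * μ⁻¹) := by
    intro a b hab
    simpa using (hν (μ⁻¹ a) (μ⁻¹ b)).1 ((hμ _ _).2 (by simpa using hab))
  have hid : ν * μ⁻¹ = 1 := by
    let e : Fin k ≃o Fin k := StrictMono.orderIsoOfSurjective _ hmono (ν * μ⁻¹).surjective
    ext a
    exact congrArg Fin.val (DFunLike.congr_fun (Subsingleton.elim e (OrderIso.refl _)) a)
  exact (mul_inv_eq_one.1 hid).symm

theorem exists_hasPatternAlong {n k : ℕ} (w : Fin k ↪ Fin n) (π : Equiv.Perm (Fin n)) :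
    ∃ μ, HasPatternAlong w π μ := by
  let f : Fin k → Fin n := fun a => π (w a)
  have hf : Function.Injective f := π.injective.comp w.injective
  have hmono : StrictMono (f ∘ Tuple.sort f) :=
    (Tuple.monotone_sort f).strictMono_of_injective (hf.comp (Tuple.sort f).injective)
  refine ⟨(Tuple.sort f)⁻¹, fun a b => ?_⟩
  simpa [f] using hmono.lt_iff_lt (a := (Tuple.sort f)⁻¹ a) (b := (Tuple.sort f)⁻¹ b)

/-- If `Q` is insensitive to rearranging the entries along `w`, then each pattern along `w`
accounts for a fraction `1 / k!` of the permutations satisfying `Q`. -/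
theorem card_hasPatternAlong_and_mul_factorial {n k : ℕ} (w : Fin k ↪ Fin n)
    (μ : Equiv.Perm (Fin k)) (Q : Equiv.Perm (Fin n) → Prop)
    (hQ : ∀ π (σ : Equiv.Perm (Fin k)), Q (π * σ.viaEmbedding w) ↔ Q π) :
    Nat.card {π : Equiv.Perm (Fin n) // HasPatternAlong w π μ ∧ Q π} * k.factorial =
      Nat.card {π : Equiv.Perm (Fin n) // Q π} := by
  have hcard : Nat.card (Equiv.Perm (Fin k)) = k.factorial := by
    rw [Nat.card_perm, Nat.card_fin]
  rw [← hcard, ← Nat.card_prod]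
  let g : {π : Equiv.Perm (Fin n) // HasPatternAlong w π μ ∧ Q π} × Equiv.Perm (Fin k) →
      {π : Equiv.Perm (Fin n) // Q π} :=
    fun p => ⟨p.1.1 * p.2.viaEmbedding w, (hQ _ _).2 p.1.2.2⟩
  refine Nat.card_congr (Equiv.ofBijective g ⟨?_, ?_⟩)
  · rintro ⟨⟨π, hπ, _⟩, σ⟩ ⟨⟨π', hπ', _⟩, σ'⟩ h
    have h : π * σ.viaEmbedding w = π' * σ'.viaEmbedding w := congrArg Subtype.val h
    have hσ : σ = σ' := by
      have h₁ := (hasPatternAlong_mul_viaEmbedding w π μ σ).2 hπ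
      have h₂ := (hasPatternAlong_mul_viaEmbedding w π' μ σ').2 hπ'
      rw [h] at h₁
      exact mul_left_cancel (h₁.unique h₂)
    subst hσ
    obtain rfl := mul_right_cancel h
    rfl
  · rintro ⟨π, hπ⟩
    obtain ⟨ρ, hρ⟩ := exists_hasPatternAlong w π
    let σ := μ⁻¹ * ρ
    have hπσ : π * (σ.viaEmbedding w)⁻¹ * σ.viaEmbedding w = π := inv_mul_cancel_right _ _
    refine ⟨⟨⟨π * (σ.viaEmbedding w)⁻¹, ?_, ?_⟩, σ⟩, Subtype.ext hπσ⟩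
    · rw [← hasPatternAlong_mul_viaEmbedding w _ μ σ, hπσ, mul_inv_cancel_left]
      exact hρ
    · rw [← hQ _ σ, hπσ]
      exact hπ

theorem card_hasPatternAlong_mul_factorial {n k : ℕ} (w : Fin k ↪ Fin n)
    (μ : Equiv.Perm (Fin k)) :
    Nat.card {π : Equiv.Perm (Fin n) // HasPatternAlong w π μ} * k.factorial = n.factorial := by
  have h := card_hasPatternAlong_and_mul_factorial w μ (fun _ => True) (fun _ _ => Iff.rfl)
  simpa [Nat.card_perm, Fintype.card_perm] using h

theorem card_hasPatternAlong_disjoint_mul_factorial {n k l : ℕ} (w : Fin k ↪ Fin n)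
    (v : Fin l ↪ Fin n) (hwv : ∀ b, v b ∉ Set.range w)
    (μ : Equiv.Perm (Fin k)) (ν : Equiv.Perm (Fin l)) :
    Nat.card {π : Equiv.Perm (Fin n) // HasPatternAlong w π μ ∧ HasPatternAlong v π ν} *
      k.factorial = Nat.card {π : Equiv.Perm (Fin n) // HasPatternAlong v π ν} := by
  refine card_hasPatternAlong_and_mul_factorial w μ _ fun π σ => ?_
  simp only [HasPatternAlong, Equiv.Perm.mul_apply]
  simp only [Equiv.Perm.viaEmbedding_apply_of_notMem σ w _ (hwv _)]

theorem count_disjoint_windows_independent (n k i j : ℕ) (hk : 1 ≤ k)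
    (hij : i + k ≤ j) (hjn : j + k ≤ n) (hik : i + k ≤ n)
    (μ ν : Equiv.Perm (Fin k)) :
    (Nat.card {π : Equiv.Perm (Fin n) //
        ContainsAt π μ i hik ∧ ContainsAt π ν j hjn} : ℝ) =
      n.factorial / (k.factorial : ℝ) ^ 2 ∧
    (Nat.card {π : Equiv.Perm (Fin n) //
        ContainsAt π μ i hik ∧ ContainsAt π ν j hjn} : ℝ) / n.factorial =
      ((Nat.card {π : Equiv.Perm (Fin n) // ContainsAt π μ i hik} : ℝ) / n.factorial) *
        ((Nat.card {π : Equiv.Perm (Fin n) // ContainsAt π ν j hjn} : ℝ) / n.factorial) := by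
  have hdisj : ∀ b, windowEmbedding j hjn b ∉ Set.range (windowEmbedding (k := k) i hik) := by
    rintro b ⟨a, hab⟩
    have : i + a.val = j + b.val := congrArg Fin.val hab
    omega
  have hμ : Nat.card {π : Equiv.Perm (Fin n) // ContainsAt π μ i hik} * k.factorial =
      n.factorial := card_hasPatternAlong_mul_factorial (windowEmbedding i hik) μ
  have hν : Nat.card {π : Equiv.Perm (Fin n) // ContainsAt π ν j hjn} * k.factorial =
      n.factorial := card_hasPatternAlong_mul_factorial (windowEmbedding j hjn) ν
  have hμν : Nat.card {π : Equiv.Perm (Fin n) //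
      ContainsAt π μ i hik ∧ ContainsAt π ν j hjn} * k.factorial =
      Nat.card {π : Equiv.Perm (Fin n) // ContainsAt π ν j hjn} :=
    card_hasPatternAlong_disjoint_mul_factorial _ _ hdisj μ ν
  have hk0 : (k.factorial : ℝ) ≠ 0 := by exact_mod_cast k.factorial_ne_zero
  have hn0 : (n.factorial : ℝ) ≠ 0 := by exact_mod_cast n.factorial_ne_zero
  rw [← hμν] at hν
  have hμ' := congrArg (Nat.cast : ℕ → ℝ) hμ
  have hμν' := congrArg (Nat.cast : ℕ → ℝ) hν
  push_cast at hμ' hμν'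
  replace hμ' := eq_div_of_mul_eq hk0 hμ'
  rw [mul_assoc, ← pow_two] at hμν'
  replace hμν' := eq_div_of_mul_eq (pow_ne_zero 2 hk0) hμν'
  refine ⟨hμν', ?_⟩
  rw [← hμν, Nat.cast_mul, hμν', hμ']
  field_simp
end

section
/- For all integers n and k with 4 ≤ k ≤ n, the expected number of distinct consecutive patterns of length k in a uniformly random permutation of {1,…,n} satisfies (1/n!) · Σ_{π ∈ S_n} X^k(π) ≥ (n−k+1) − 4n²·(e/k)^k − 8n/(k−3). -/
/-- `Xk n k π` is the number of distinct patterns of length `k` consecutively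
contained in `π` at some position. -/
noncomputable def Xk (n k : ℕ) (π : Equiv.Perm (Fin n)) : ℕ :=
  Nat.card {μ : Equiv.Perm (Fin k) // ∃ (i : ℕ) (h : i + k ≤ n), ContainsAt π μ i h}

open Equiv Finset

/-- The length `k` windows of `π` starting at positions `i` and `j` are order isomorphic. -/
def SamePattern {n : ℕ} (k : ℕ) (π : Perm (Fin n)) (i j : ℕ) : Prop :=
  ∀ a < k, ∀ b < k, ∀ x y x' y' : Fin n, x.val = i + a → y.val = i + b →
    x'.val = j + a → y'.val = j + b → (π x < π y ↔ π x' < π y')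

/-- A permutation preserving the order induced by an injective function is trivial. -/
lemma perm_eq_one_of_lt_iff {α β : Type*} [Fintype α] [LinearOrder β] (h : α → β)
    (hh : Function.Injective h) (ρ : Perm α)
    (H : ∀ a b, h (ρ a) < h (ρ b) ↔ h a < h b) : ρ = 1 := by
  let _ : LinearOrder α := LinearOrder.lift' h hh
  let e : α ≃o α := ⟨ρ, by
    intro a b
    have := H b a
    change h (ρ a) ≤ h (ρ b) ↔ h a ≤ h b
    rw [← not_lt, ← not_lt, this]⟩
  have he : e = OrderIso.refl α := Subsingleton.elim _ _
  ext a
  exact congrArg (fun e : α ≃o α => e a) he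

/-- If permuting the positions in the range of `f` nontrivially always leads out of `E`,
then `E` makes up at most a fraction `1 / m!` of all permutations. -/
lemma card_mul_factorial_le_s9 {n m : ℕ} (f : Fin m ↪ Fin n) (E : Finset (Perm (Fin n)))
    (hE : ∀ π ∈ E, ∀ ρ : Perm (Fin m), π * Perm.viaEmbeddingHom f ρ ∈ E →
      ∀ a b, (π (f (ρ a)) < π (f (ρ b)) ↔ π (f a) < π (f b))) :
    E.card * m.factorial ≤ n.factorial := by
  have key : (E ×ˢ (univ : Finset (Perm (Fin m)))).card ≤
      (univ : Finset (Perm (Fin n))).card := by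
    refine card_le_card_of_injOn (fun p => p.1 * Perm.viaEmbeddingHom f p.2)
      (fun _ _ => mem_coe.2 (mem_univ _)) ?_
    rintro ⟨π, ρ⟩ h ⟨π', ρ'⟩ h' heq
    simp only [coe_product, Set.mem_prod, mem_coe] at h h' heq
    have h1 : π' = π * Perm.viaEmbeddingHom f (ρ * ρ'⁻¹) := by
      rw [map_mul, map_inv, ← mul_assoc, heq, mul_inv_cancel_right]
    have h2 : ρ * ρ'⁻¹ = 1 :=
      perm_eq_one_of_lt_iff (fun a => π (f a)) (π.injective.comp f.injective) _
        (hE π h.1 _ (h1 ▸ h'.1))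
    rw [h2, map_one, mul_one] at h1
    rw [h1, mul_inv_eq_one.1 h2]
  simpa [card_product, Fintype.card_perm] using key

lemma viaEmbeddingHom_apply_image {m n : ℕ} (f : Fin m ↪ Fin n) (ρ : Perm (Fin m)) (a : Fin m) :
    Perm.viaEmbeddingHom f ρ (f a) = f (ρ a) := by
  rw [Perm.viaEmbeddingHom_apply, Perm.viaEmbedding_apply]

open Classical in
/-- Equality of the patterns at two windows, restricted to disjoint initial segments. -/
lemma card_samePattern_mul_factorial_le {n k m i j : ℕ} (hmk : m ≤ k) (hm : i + m ≤ j)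
    (hj : j + k ≤ n) :
    (univ.filter fun π : Perm (Fin n) => SamePattern k π i j).card * m.factorial
      ≤ n.factorial := by
  let f : Fin m ↪ Fin n := ⟨fun a => ⟨j + a, by omega⟩, fun a b h => by
    simp only [Fin.mk.injEq] at h; ext; omega⟩
  refine card_mul_factorial_le_s9 f _ ?_
  intro π hπ ρ hρ a b
  simp only [mem_filter, mem_univ, true_and] at hπ hρ
  let g : Fin m → Fin n := fun a => ⟨i + a, by omega⟩
  have hg : ∀ a, Perm.viaEmbeddingHom f ρ (g a) = g a := by
    intro a
    rw [Perm.viaEmbeddingHom_apply]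
    refine Perm.viaEmbedding_apply_of_notMem _ _ _ ?_
    rintro ⟨c, hc⟩
    have : j + c.val = i + a.val := congrArg Fin.val hc
    omega
  have h1 := hπ a (by omega) b (by omega) (g a) (g b) (f a) (f b) rfl rfl rfl rfl
  have h2 := hρ a (by omega) b (by omega) (g a) (g b) (f a) (f b) rfl rfl rfl rfl
  simp only [Perm.mul_apply, hg, viaEmbeddingHom_apply_image] at h2
  rw [← h2, h1]

open Classical in
lemma card_strictMono_mul_factorial_le {n m : ℕ} (f : Fin m ↪ Fin n) :
    (univ.filter fun π : Perm (Fin n) => StrictMono (π ∘ f)).card * m.factorial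
      ≤ n.factorial := by
  refine card_mul_factorial_le_s9 f _ ?_
  intro π hπ ρ hρ a b
  simp only [mem_filter, mem_univ, true_and] at hπ hρ
  have h1 := hπ.lt_iff_lt (a := a) (b := b)
  have h2 := hρ.lt_iff_lt (a := a) (b := b)
  simp only [Function.comp_apply, Perm.mul_apply, viaEmbeddingHom_apply_image] at h1 h2
  rw [h1, h2]

open Classical in
lemma card_strictAnti_mul_factorial_le {n m : ℕ} (f : Fin m ↪ Fin n) :
    (univ.filter fun π : Perm (Fin n) => StrictAnti (π ∘ f)).card * m.factorial
      ≤ n.factorial := by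
  refine card_mul_factorial_le_s9 f _ ?_
  intro π hπ ρ hρ a b
  simp only [mem_filter, mem_univ, true_and] at hπ hρ
  have h1 := hπ.lt_iff_gt (a := a) (b := b)
  have h2 := hρ.lt_iff_gt (a := a) (b := b)
  simp only [Function.comp_apply, Perm.mul_apply, viaEmbeddingHom_apply_image] at h1 h2
  rw [h1, h2]

/-- If the windows at `i` and `i + d` have the same pattern, then `π` is monotone along the
arithmetic progression `i, i + d, i + 2 * d, …`. -/
lemma SamePattern.strictMono_or_strictAnti {n k t i d : ℕ} {π : Perm (Fin n)}
    (hπ : SamePattern k π i (i + d)) (ht : t * d < k) (f : Fin (t + 2) ↪ Fin n)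
    (hf : ∀ a, (f a).val = i + a.val * d) : StrictMono (π ∘ f) ∨ StrictAnti (π ∘ f) := by
  have step : ∀ s (hs : s < t),
      (π (f ⟨s, by omega⟩) < π (f ⟨s + 1, by omega⟩) ↔
        π (f ⟨s + 1, by omega⟩) < π (f ⟨s + 2, by omega⟩)) := by
    intro s hs
    have h1 : (s + 1) * d ≤ t * d := Nat.mul_le_mul_right _ hs
    refine hπ (s * d) (by nlinarith) ((s + 1) * d) (by omega) _ _ _ _ ?_ ?_ ?_ ?_ <;>
      rw [hf] <;> dsimp only <;> ring
  have all : ∀ s (hs : s < t + 1),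
      (π (f ⟨s, by omega⟩) < π (f ⟨s + 1, by omega⟩) ↔
        π (f ⟨0, by omega⟩) < π (f ⟨1, by omega⟩)) := by
    intro s
    induction s with
    | zero => intro _; rfl
    | succ s ih =>
      intro hs
      rw [← ih (by omega), step s (by omega)]
  by_cases h0 : π (f ⟨0, by omega⟩) < π (f ⟨1, by omega⟩)
  · left
    rw [Fin.strictMono_iff_lt_succ]
    intro s
    exact (all s s.isLt).2 h0
  · right
    rw [Fin.strictAnti_iff_succ_lt]
    intro s
    have h1 := mt (all s s.isLt).1 h0
    refine lt_of_le_of_ne (not_lt.1 h1) fun h => ?_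
    have := congrArg Fin.val (f.injective (π.injective h))
    simp at this

open Classical in
lemma card_samePattern_mul_factorial_le_two_mul {n k t i d : ℕ} (hd : 0 < d) (ht : t * d < k)
    (hn : i + d + k ≤ n) :
    (univ.filter fun π : Perm (Fin n) => SamePattern k π i (i + d)).card * (t + 2).factorial
      ≤ 2 * n.factorial := by
  let f : Fin (t + 2) ↪ Fin n := ⟨fun a => ⟨i + a.val * d, by
      have : a.val * d ≤ (t + 1) * d := Nat.mul_le_mul_right _ (by omega)
      nlinarith⟩, fun a b h => by
    simp only [Fin.mk.injEq, add_right_inj] at h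
    exact Fin.ext (Nat.eq_of_mul_eq_mul_right hd h)⟩
  have hsub : (univ.filter fun π : Perm (Fin n) => SamePattern k π i (i + d)) ⊆
      (univ.filter fun π : Perm (Fin n) => StrictMono (π ∘ f)) ∪
      (univ.filter fun π : Perm (Fin n) => StrictAnti (π ∘ f)) := by
    intro π hπ
    simp only [mem_filter, mem_univ, true_and, mem_union] at hπ ⊢
    exact hπ.strictMono_or_strictAnti ht f fun _ => rfl
  have h := (card_le_card hsub).trans (card_union_le _ _)
  have h1 := card_strictMono_mul_factorial_le f
  have h2 := card_strictAnti_mul_factorial_le f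
  have h3 := Nat.mul_le_mul_right (t + 2).factorial h
  rw [add_mul] at h3
  omega

open Classical in
/-- Overlapping windows at distance `d` rarely have the same pattern. -/
lemma card_samePattern_overlap_le {n k i d : ℕ} (hd : 0 < d) (hdk : d < k)
    (hn : i + d + k ≤ n) :
    k * (univ.filter fun π : Perm (Fin n) => SamePattern k π i (i + d)).card * d.factorial
      ≤ n.factorial * d ^ 2 := by
  set C := (univ.filter fun π : Perm (Fin n) => SamePattern k π i (i + d)).card with hC
  obtain ⟨t, ht, hk⟩ : ∃ t, t * d < k ∧ k ≤ (t + 1) * d := by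
    refine ⟨(k - 1) / d, ?_, ?_⟩
    · have := Nat.div_mul_le_self (k - 1) d
      omega
    · have := Nat.lt_div_mul_add (a := k - 1) hd
      rw [add_mul]
      omega
  have h1 : C * d.factorial ≤ n.factorial :=
    card_samePattern_mul_factorial_le hdk.le le_rfl hn
  have h2 : C * (t + 2).factorial ≤ 2 * n.factorial :=
    card_samePattern_mul_factorial_le_two_mul hd ht hn
  by_cases htd : t + 1 ≤ d
  · have : k ≤ d ^ 2 := by nlinarith
    calc k * C * d.factorial = k * (C * d.factorial) := by ring
      _ ≤ d ^ 2 * n.factorial := Nat.mul_le_mul this h1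
      _ = _ := by ring
  · have hf : d.factorial ≤ t.factorial := Nat.factorial_le (by omega)
    have h3 : (t + 2).factorial = (t + 2) * ((t + 1) * t.factorial) := by
      rw [Nat.factorial_succ, Nat.factorial_succ]
    have h4 : 2 ≤ d * (t + 2) := by nlinarith
    refine le_of_mul_le_mul_left (a := t + 2) ?_ (by omega)
    calc (t + 2) * (k * C * d.factorial)
        ≤ (t + 2) * ((t + 1) * d * C * t.factorial) := by gcongr
      _ = d * (C * (t + 2).factorial) := by rw [h3]; ring
      _ ≤ d * (2 * n.factorial) := by gcongr
      _ ≤ d * (d * (t + 2) * n.factorial) := by gcongr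
      _ = (t + 2) * (n.factorial * d ^ 2) := by ring

lemma exists_containsAt {n k i : ℕ} (π : Perm (Fin n)) (h : i + k ≤ n) :
    ∃ μ : Perm (Fin k), ContainsAt π μ i h := by
  let g : Fin k → Fin n := fun a => π ⟨i + a.val, by omega⟩
  have hg : Function.Injective g := fun a b hab => by
    have := congrArg Fin.val (π.injective hab)
    simp only at this
    ext; omega
  have hs : StrictMono (g ∘ Tuple.sort g) :=
    (Tuple.monotone_sort g).strictMono_of_injective (hg.comp (Tuple.sort g).injective)
  refine ⟨(Tuple.sort g)⁻¹, fun a b => ?_⟩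
  have := hs.lt_iff_lt (a := (Tuple.sort g)⁻¹ a) (b := (Tuple.sort g)⁻¹ b)
  simpa [g] using this

lemma ContainsAt.samePattern {n k i j : ℕ} {π : Perm (Fin n)} {μ : Perm (Fin k)}
    {hi : i + k ≤ n} {hj : j + k ≤ n} (h : ContainsAt π μ i hi) (h' : ContainsAt π μ j hj) :
    SamePattern k π i j := by
  rintro a ha b hb ⟨x, _⟩ ⟨y, _⟩ ⟨x', _⟩ ⟨y', _⟩ hx hy hx' hy'
  dsimp only at hx hy hx' hy'
  subst hx hy hx' hy'
  exact (h ⟨a, ha⟩ ⟨b, hb⟩).trans (h' ⟨a, ha⟩ ⟨b, hb⟩).symm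

/-- The number of values of `f` is at least the number of arguments minus the number of
colliding pairs. -/
lemma le_card_image_add_collisions {β : Type*} [DecidableEq β] (N : ℕ) (f : ℕ → β) :
    N ≤ ((range N).image f).card +
      ∑ j ∈ range N, ((range j).filter fun i => f i = f j).card := by
  induction N with
  | zero => simp
  | succ N ih =>
    rw [sum_range_succ, range_add_one, image_insert]
    by_cases h : f N ∈ (range N).image f
    · rw [insert_eq_of_mem h]
      obtain ⟨i, hi, hfi⟩ := mem_image.1 h
      have : 0 < ((range N).filter fun i => f i = f N).card :=
        card_pos.2 ⟨i, mem_filter.2 ⟨hi, hfi⟩⟩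
      omega
    · rw [card_insert_of_notMem h]
      omega

open Classical in
lemma le_Xk_add_collisions {n k : ℕ} (hkn : k ≤ n) (π : Perm (Fin n)) :
    n - k + 1 ≤ Xk n k π +
      ∑ j ∈ range (n - k + 1), ∑ i ∈ range j, if SamePattern k π i j then 1 else 0 := by
  have hex : ∀ i, ∃ μ : Perm (Fin k), ∀ h : i + k ≤ n, ContainsAt π μ i h := by
    intro i
    by_cases h : i + k ≤ n
    · obtain ⟨μ, hμ⟩ := exists_containsAt π h
      exact ⟨μ, fun _ => hμ⟩
    · exact ⟨1, fun h' => absurd h' h⟩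
  choose p hp using hex
  refine (le_card_image_add_collisions (n - k + 1) p).trans (add_le_add ?_ ?_)
  · rw [Xk, Nat.card_eq_fintype_card, Fintype.card_subtype]
    refine card_le_card fun μ hμ => ?_
    obtain ⟨i, hi, rfl⟩ := mem_image.1 hμ
    have hi' : i + k ≤ n := by have := mem_range.1 hi; omega
    exact mem_filter.2 ⟨mem_univ _, i, hi', hp i hi'⟩
  · refine sum_le_sum fun j hj => ?_
    rw [card_filter]
    refine sum_le_sum fun i hi => ?_
    have hj' : j + k ≤ n := by have := mem_range.1 hj; omega
    have hi' : i + k ≤ n := by have := mem_range.1 hi; omega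
    by_cases h : p i = p j
    · rw [if_pos h, if_pos]
      exact (hp i hi').samePattern (h ▸ hp j hj')
    · rw [if_neg h]
      exact Nat.zero_le _

open Classical in
/-- The proportion of permutations having the same pattern at positions `i < j`. -/
lemma card_samePattern_le {n k i j : ℕ} (hk : 0 < k) (hij : i < j) (hj : j + k ≤ n) :
    ((univ.filter fun π : Perm (Fin n) => SamePattern k π i j).card : ℝ) ≤
      n.factorial * (1 / k.factorial + ((j - i : ℕ) : ℝ) ^ 2 / (j - i).factorial / k) := by
  have hk' : (0 : ℝ) < k := by exact_mod_cast hk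
  by_cases hd : j - i < k
  · obtain ⟨d, rfl⟩ := Nat.exists_eq_add_of_le hij.le
    simp only [Nat.add_sub_cancel_left] at hd ⊢
    have h := card_samePattern_overlap_le (n := n) (i := i) (by omega) hd hj
    have hdf : (0 : ℝ) < d.factorial := by positivity
    have h' : (k : ℝ) * (univ.filter fun π : Perm (Fin n) => SamePattern k π i (i + d)).card
        * d.factorial ≤ n.factorial * (d : ℝ) ^ 2 := by exact_mod_cast h
    calc _ ≤ (n.factorial : ℝ) * ((d : ℝ) ^ 2 / d.factorial / k) := by
          rw [div_div, ← mul_div_assoc, le_div_iff₀ (by positivity)]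
          linarith
      _ ≤ _ := by
          gcongr
          exact le_add_of_nonneg_left (by positivity)
  · have h : ((univ.filter fun π : Perm (Fin n) => SamePattern k π i j).card : ℝ)
        * k.factorial ≤ n.factorial := by
      exact_mod_cast card_samePattern_mul_factorial_le (i := i) le_rfl (by omega) hj
    calc _ ≤ (n.factorial : ℝ) * (1 / k.factorial) := by
          rw [mul_one_div, le_div_iff₀ (by positivity)]
          exact h
      _ ≤ _ := by
          gcongr
          exact le_add_of_nonneg_right (by positivity)

lemma sum_sq_div_factorial_le (m : ℕ) :
    ∑ d ∈ range m, ((d : ℝ) + 1) ^ 2 / (d + 1).factorial ≤ 6 := by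
  have h : ∀ m : ℕ, ∑ d ∈ range (m + 2), ((d : ℝ) + 1) ^ 2 / (d + 1).factorial ≤
      6 - 3 / ((m + 1).factorial : ℝ) := by
    intro m
    induction m with
    | zero => norm_num [sum_range_succ]
    | succ m ih =>
      rw [sum_range_succ]
      refine (add_le_add_left ih _).trans ?_
      have hf : (0 : ℝ) < (m + 1).factorial := by positivity
      have e1 : ((m + 2 + 1).factorial : ℝ) = (m + 3) * ((m + 2) * (m + 1).factorial) := by
        rw [Nat.factorial_succ (m + 2), Nat.factorial_succ (m + 1)]; push_cast; ring
      have e2 : ((m + 1 + 1).factorial : ℝ) = (m + 2) * (m + 1).factorial := by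
        rw [Nat.factorial_succ (m + 1)]; push_cast; ring
      rw [e1, e2]
      push_cast
      have : 3 / ((m + 1).factorial : ℝ) - ((m : ℝ) + 2 + 1) ^ 2 /
          ((m + 3) * ((m + 2) * (m + 1).factorial)) - 3 / ((m + 2) * (m + 1).factorial)
          = 2 * m / ((m + 2) * (m + 1).factorial) := by
        field_simp
        ring
      have : (0 : ℝ) ≤ 2 * m / ((m + 2) * (m + 1).factorial) := by positivity
      linarith
  have h1 := h m
  have h2 : ∑ d ∈ range m, ((d : ℝ) + 1) ^ 2 / (d + 1).factorial ≤
      ∑ d ∈ range (m + 2), ((d : ℝ) + 1) ^ 2 / (d + 1).factorial :=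
    sum_le_sum_of_subset_of_nonneg (range_subset_range.2 (by omega))
      fun _ _ _ => by positivity
  have h3 : (0 : ℝ) ≤ 3 / (m + 1).factorial := by positivity
  linarith

lemma one_div_factorial_le {k : ℕ} (hk : 0 < k) :
    1 / (k.factorial : ℝ) ≤ (Real.exp 1 / k) ^ k := by
  have h := Real.pow_div_factorial_le_exp (k : ℝ) (by positivity) k
  have hk' : (0 : ℝ) < (k : ℝ) ^ k := by positivity
  rw [div_pow, ← Real.exp_nat_mul, mul_one, le_div_iff₀ hk']
  calc _ = (k : ℝ) ^ k / k.factorial := by ring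
    _ ≤ _ := h

open Classical in
/-- The expected number of colliding pairs of windows. -/
lemma sum_card_samePattern_le {n k : ℕ} (hk : 0 < k) (hkn : k ≤ n) :
    ∑ j ∈ range (n - k + 1), ∑ i ∈ range j,
      ((univ.filter fun π : Perm (Fin n) => SamePattern k π i j).card : ℝ) ≤
    n.factorial * (n * (n * (1 / k.factorial) + 6 / k)) := by
  have hN : ((n - k + 1 : ℕ) : ℝ) ≤ n := by
    exact_mod_cast (by omega : n - k + 1 ≤ n)
  calc _ ≤ ∑ j ∈ range (n - k + 1),
        (n.factorial : ℝ) * (n * (1 / k.factorial) + 6 / k) := by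
        refine sum_le_sum fun j hj => ?_
        have hj' := mem_range.1 hj
        calc _ ≤ ∑ i ∈ range j, (n.factorial : ℝ) *
              (1 / k.factorial + ((j - i : ℕ) : ℝ) ^ 2 / (j - i).factorial / k) :=
              sum_le_sum fun i hi =>
                card_samePattern_le hk (mem_range.1 hi) (by omega)
          _ = (n.factorial : ℝ) * (j * (1 / k.factorial) +
              (∑ d ∈ range j, ((d : ℝ) + 1) ^ 2 / (d + 1).factorial) / k) := by
              rw [← mul_sum, sum_add_distrib, sum_const, card_range, nsmul_eq_mul, sum_div,
                ← sum_range_reflect]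
              congr 2
              refine sum_congr rfl fun i hi => ?_
              have hi' := mem_range.1 hi
              have : j - (j - 1 - i) = i + 1 := by omega
              rw [this]
              push_cast
              rfl
          _ ≤ _ := by
              have hjn : (j : ℝ) ≤ n := by exact_mod_cast (by omega : j ≤ n)
              gcongr
              exact sum_sq_div_factorial_le j
    _ = ((n - k + 1 : ℕ) : ℝ) * ((n.factorial : ℝ) * (n * (1 / k.factorial) + 6 / k)) := by
        rw [sum_const, card_range, nsmul_eq_mul]
    _ ≤ (n : ℝ) * ((n.factorial : ℝ) * (n * (1 / k.factorial) + 6 / k)) := by gcongr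
    _ = _ := by ring

theorem expected_Xk_lower_bound (n k : ℕ) (hk : 4 ≤ k) (hkn : k ≤ n) :
    (1 / (n.factorial : ℝ)) * ∑ π : Equiv.Perm (Fin n), (Xk n k π : ℝ) ≥
      ((n : ℝ) - k + 1) - 4 * (n : ℝ) ^ 2 * (Real.exp 1 / k) ^ k -
        8 * n / ((k : ℝ) - 3) := by
  classical
  have hsum : (n.factorial : ℝ) * ((n : ℝ) - k + 1) ≤
      ∑ π : Equiv.Perm (Fin n), (Xk n k π : ℝ) + ∑ j ∈ range (n - k + 1), ∑ i ∈ range j,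
        ((univ.filter fun π : Perm (Fin n) => SamePattern k π i j).card : ℝ) := by
    have h := sum_le_sum fun (π : Perm (Fin n)) (_ : π ∈ univ) => le_Xk_add_collisions hkn π
    rw [sum_const, card_univ, Fintype.card_perm, Fintype.card_fin, smul_eq_mul,
      sum_add_distrib, sum_comm] at h
    simp_rw [sum_comm (s := univ) (t := range _), ← card_filter] at h
    have h' : ((n.factorial * (n - k + 1) : ℕ) : ℝ) ≤ _ := Nat.cast_le.2 h
    push_cast [Nat.cast_sub hkn] at h'
    exact h'
  have hcol := sum_card_samePattern_le (n := n) (k := k) (by omega) hkn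
  have hfac : (0 : ℝ) < n.factorial := by positivity
  have hk4 : (4 : ℝ) ≤ k := by exact_mod_cast hk
  have hE := one_div_factorial_le (k := k) (by omega)
  have h1 : (n : ℝ) ^ 2 * (1 / k.factorial) ≤ 4 * (n : ℝ) ^ 2 * (Real.exp 1 / k) ^ k := by
    have h2 : (n : ℝ) ^ 2 * (1 / k.factorial) ≤ (n : ℝ) ^ 2 * (Real.exp 1 / k) ^ k := by gcongr
    have h3 : (0 : ℝ) ≤ (n : ℝ) ^ 2 * (Real.exp 1 / k) ^ k := by positivity
    linarith
  have h2 : (n : ℝ) * (6 / k) ≤ 8 * n / ((k : ℝ) - 3) := by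
    rw [← mul_div_assoc, mul_comm (n : ℝ)]
    have : (0 : ℝ) < k - 3 := by linarith
    gcongr <;> linarith
  rw [ge_iff_le, one_div, inv_mul_eq_div, le_div_iff₀ hfac]
  have h3 : (n.factorial : ℝ) * (n * (n * (1 / k.factorial) + 6 / k)) ≤
      n.factorial * (4 * (n : ℝ) ^ 2 * (Real.exp 1 / k) ^ k + 8 * n / ((k : ℝ) - 3)) := by
    refine mul_le_mul_of_nonneg_left ?_ hfac.le
    calc _ = (n : ℝ) ^ 2 * (1 / k.factorial) + n * (6 / k) := by ring
      _ ≤ _ := add_le_add h1 h2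
  nlinarith
end
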